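/- arXiv:2509.17356 — 6 statements merged into one kernel-verified Lean document; each statement's English description precedes it below -/
import Mathlib

section
/- Let d ≥ 1, let ι be a finite index set, let g : ι → M_d(ℂ) be any family of matrices, let J : ι → ℝ, and set H := −Σ_{i∈ι} J_i · g_i. Let P, U ∈ M_d(ℂ) be unitary, and suppose that for every i ∈ ι there are signs c_i, d_i ∈ {−1, 1} with g_i·P = c_i·P·g_i and g_i·U = d_i·U·g_i. Then P†U†HUP + U†HU − P†HP − H = 4 · Σ_{i∈ι : c_i = 1 and d_i = −1} J_i · g_i. -/
open Matrix

/-- For `H = -∑ i, J i • g i` and unitaries `P, U` that commute or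
anticommute with each `g i` (with signs `c i`, `d i` respectively), the energy-barrier
operator satisfies the exact identity
`P† U† H U P + U† H U - P† H P - H = 4 • ∑_{i : c i = 1 ∧ d i = -1} J i • g i`. -/
theorem stmt_0 {d : ℕ} (hd : 1 ≤ d) {ι : Type*} [Fintype ι]
    (g : ι → Matrix (Fin d) (Fin d) ℂ) (J : ι → ℝ)
    (H : Matrix (Fin d) (Fin d) ℂ) (hH : H = -∑ i, (J i : ℂ) • g i)
    (P U : Matrix (Fin d) (Fin d) ℂ)
    (hP : P ∈ Matrix.unitaryGroup (Fin d) ℂ) (hU : U ∈ Matrix.unitaryGroup (Fin d) ℂ)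
    (c e : ι → ℝ)
    (hc : ∀ i, c i = 1 ∨ c i = -1) (he : ∀ i, e i = 1 ∨ e i = -1)
    (hgP : ∀ i, g i * P = (c i : ℂ) • (P * g i))
    (hgU : ∀ i, g i * U = (e i : ℂ) • (U * g i)) :
    Pᴴ * Uᴴ * H * U * P + Uᴴ * H * U - Pᴴ * H * P - H
      = (4 : ℂ) • ∑ i ∈ Finset.univ.filter (fun i => c i = 1 ∧ e i = -1), (J i : ℂ) • g i := by
  have hP' : Pᴴ * P = 1 := (Matrix.mem_unitaryGroup_iff'.mp hP)
  have hU' : Uᴴ * U = 1 := (Matrix.mem_unitaryGroup_iff'.mp hU)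
  have h1 : ∀ i, Pᴴ * g i * P = (c i : ℂ) • g i := fun i => by
    rw [Matrix.mul_assoc, hgP, Matrix.mul_smul, ← Matrix.mul_assoc, hP', Matrix.one_mul]
  have h2 : ∀ i, Uᴴ * g i * U = (e i : ℂ) • g i := fun i => by
    rw [Matrix.mul_assoc, hgU, Matrix.mul_smul, ← Matrix.mul_assoc, hU', Matrix.one_mul]
  have hPH : Pᴴ * H * P = -∑ i, (J i : ℂ) • (c i : ℂ) • g i := by
    simp only [hH, Matrix.mul_neg, Matrix.neg_mul, Finset.mul_sum, Finset.sum_mul,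
      Matrix.mul_smul, Matrix.smul_mul, h1]
  have hUH : Uᴴ * H * U = -∑ i, (J i : ℂ) • (e i : ℂ) • g i := by
    simp only [hH, Matrix.mul_neg, Matrix.neg_mul, Finset.mul_sum, Finset.sum_mul,
      Matrix.mul_smul, Matrix.smul_mul, h2]
  have hPU : Pᴴ * Uᴴ * H * U * P = -∑ i, (J i : ℂ) • (e i : ℂ) • (c i : ℂ) • g i := by
    have h3 : Pᴴ * Uᴴ * H * U * P = Pᴴ * (Uᴴ * H * U) * P := by
      simp only [Matrix.mul_assoc]
    rw [h3, hUH]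
    simp only [Matrix.mul_neg, Matrix.neg_mul, Finset.mul_sum, Finset.sum_mul,
      Matrix.mul_smul, Matrix.smul_mul, h1]
  rw [hPU, hUH, hPH, hH, Finset.sum_filter, Finset.smul_sum]
  simp only [← Finset.sum_neg_distrib, ← Finset.sum_add_distrib, ← Finset.sum_sub_distrib]
  refine Finset.sum_congr rfl fun i _ => ?_
  have hne : ¬ ((-1 : ℝ) = 1) := by norm_num
  have hne' : ¬ ((1 : ℝ) = -1) := by norm_num
  rcases hc i with h | h <;> rcases he i with h' | h' <;>
    simp only [h, h', hne, hne', and_self, and_true, and_false, if_true, if_false,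
      Complex.ofReal_neg, Complex.ofReal_one, smul_zero] <;> module
end

section
/- Let d ≥ 1, let ι be a finite index set, let g : ι → M_d(ℂ) with every g_i unitary, let J : ι → ℝ, and set H := −Σ_{i∈ι} J_i · g_i. Let P, U ∈ M_d(ℂ) be unitary, and suppose that for every i ∈ ι there are signs c_i, d_i ∈ {−1, 1} with g_i·P = c_i·P·g_i and g_i·U = d_i·U·g_i. Then ‖P†U†HUP + U†HU − P†HP − H‖ ≤ 4 · Σ_{i∈ι : c_i = 1 and d_i = −1} |J_i|, where ‖·‖ is the operator norm. -/
open Matrix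

noncomputable section

/-- The `ℓ²` operator norm of a matrix. -/
def opNorm {m : Type*} [Fintype m] [DecidableEq m] (A : Matrix m m ℂ) : ℝ :=
  ‖Matrix.toEuclideanCLM (𝕜 := ℂ) A‖

theorem opNorm_unitary_le {d : ℕ} (g : Matrix (Fin d) (Fin d) ℂ)
    (hg : g ∈ Matrix.unitaryGroup (Fin d) ℂ) :
    ‖Matrix.toEuclideanCLM (𝕜 := ℂ) g‖ ≤ 1 := by
  have h1 : star g * g = 1 := (Matrix.mem_unitaryGroup_iff').1 hg
  have h2 : star (Matrix.toEuclideanCLM (𝕜 := ℂ) g) * Matrix.toEuclideanCLM (𝕜 := ℂ) g = 1 := by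
    rw [← map_star, ← map_mul, h1, map_one]
  have h3 := CStarRing.norm_star_mul_self (x := Matrix.toEuclideanCLM (𝕜 := ℂ) g)
  rw [h2] at h3
  have h4 : ‖(1 : EuclideanSpace ℂ (Fin d) →L[ℂ] EuclideanSpace ℂ (Fin d))‖ ≤ 1 :=
    ContinuousLinearMap.norm_id_le
  nlinarith [norm_nonneg (Matrix.toEuclideanCLM (𝕜 := ℂ) g)]

theorem conj_sign {d : ℕ} (g P : Matrix (Fin d) (Fin d) ℂ)
    (hP : P ∈ Matrix.unitaryGroup (Fin d) ℂ) (c : ℂ) (h : g * P = c • (P * g)) :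
    Pᴴ * g * P = c • g := by
  have h1 : Pᴴ * P = 1 := (Matrix.mem_unitaryGroup_iff').1 hP
  rw [Matrix.mul_assoc, h, Matrix.mul_smul, ← Matrix.mul_assoc, h1, Matrix.one_mul]

/-- For a stabilizer-type Hamiltonian `H = -∑ i, J i • g i` with unitary
terms `g i`, and unitaries `P, U` commuting or anticommuting with each `g i` (with signs
`c i`, `d i`), the energy-barrier cost satisfies
`‖P† U† H U P + U† H U - P† H P - H‖ ≤ 4 * ∑_{i : c i = 1 ∧ d i = -1} |J i|`. -/
theorem stmt_1 {d : ℕ} (hd : 1 ≤ d) {ι : Type*} [Fintype ι]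
    (g : ι → Matrix (Fin d) (Fin d) ℂ)
    (hg : ∀ i, g i ∈ Matrix.unitaryGroup (Fin d) ℂ) (J : ι → ℝ)
    (H : Matrix (Fin d) (Fin d) ℂ) (hH : H = -∑ i, (J i : ℂ) • g i)
    (P U : Matrix (Fin d) (Fin d) ℂ)
    (hP : P ∈ Matrix.unitaryGroup (Fin d) ℂ) (hU : U ∈ Matrix.unitaryGroup (Fin d) ℂ)
    (c e : ι → ℝ)
    (hc : ∀ i, c i = 1 ∨ c i = -1) (he : ∀ i, e i = 1 ∨ e i = -1)
    (hgP : ∀ i, g i * P = (c i : ℂ) • (P * g i))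
    (hgU : ∀ i, g i * U = (e i : ℂ) • (U * g i)) :
    opNorm (Pᴴ * Uᴴ * H * U * P + Uᴴ * H * U - Pᴴ * H * P - H)
      ≤ 4 * ∑ i ∈ Finset.univ.filter (fun i => c i = 1 ∧ e i = -1), |J i| := by
  have hUU : Uᴴ * H * U = -∑ i, ((J i : ℂ) * (e i : ℂ)) • g i := by
    rw [hH]
    simp only [Matrix.mul_neg, Matrix.neg_mul, Matrix.mul_sum, Matrix.sum_mul, Matrix.mul_smul,
      Matrix.smul_mul, conj_sign _ _ hU _ (hgU _), smul_smul]
  have hPP : Pᴴ * H * P = -∑ i, ((J i : ℂ) * (c i : ℂ)) • g i := by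
    rw [hH]
    simp only [Matrix.mul_neg, Matrix.neg_mul, Matrix.mul_sum, Matrix.sum_mul, Matrix.mul_smul,
      Matrix.smul_mul, conj_sign _ _ hP _ (hgP _), smul_smul]
  have hPU : Pᴴ * Uᴴ * H * U * P = -∑ i, ((J i : ℂ) * (e i : ℂ) * (c i : ℂ)) • g i := by
    have : Pᴴ * Uᴴ * H * U * P = Pᴴ * (Uᴴ * H * U) * P := by simp only [Matrix.mul_assoc]
    rw [this, hUU]
    simp only [Matrix.mul_neg, Matrix.neg_mul, Matrix.mul_sum, Matrix.sum_mul, Matrix.mul_smul,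
      Matrix.smul_mul, conj_sign _ _ hP _ (hgP _), smul_smul]
  have key : Pᴴ * Uᴴ * H * U * P + Uᴴ * H * U - Pᴴ * H * P - H
      = ∑ i, ((-(J i * ((c i + 1) * (e i - 1))) : ℝ) : ℂ) • g i := by
    rw [hPU, hUU, hPP, hH]
    simp only [← Finset.sum_neg_distrib, ← Finset.sum_add_distrib, ← Finset.sum_sub_distrib]
    refine Finset.sum_congr rfl fun i _ => ?_
    push_cast
    module
  unfold opNorm
  rw [key, map_sum, Finset.mul_sum, Finset.sum_filter]
  refine (norm_sum_le _ _).trans (Finset.sum_le_sum fun i _ => ?_)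
  rw [map_smul, norm_smul, Complex.norm_real, Real.norm_eq_abs]
  have hn := opNorm_unitary_le (g i) (hg i)
  rcases hc i with h1 | h1 <;> rcases he i with h2 | h2 <;> rw [h1, h2]
  · norm_num
  · have : |(-(J i * ((1 + 1) * (-1 - 1))) : ℝ)| = 4 * |J i| := by
      rw [abs_neg, abs_mul]; norm_num; ring
    rw [this]
    simp only [and_self, if_true]
    exact mul_le_of_le_one_right (by positivity) hn
  · norm_num
  · norm_num
end
end

section
/- Let S₁, …, S_r ∈ 𝒫ⁿ be pairwise commuting and independent (∏_{j∈T} S_j ∉ {𝟙, −𝟙} for every nonempty T ⊆ {1,…,r}), and for s ∈ {−1,1}^r set Π_s := ∏_{j=1}^r (𝟙 + s_j S_j)/2. Let ι be a finite index set, T_i ⊆ {1,…,r} and J_i ∈ ℝ for i ∈ ι, g_i := ∏_{j∈T_i} S_j, and H := −Σ_{i∈ι} J_i g_i. Define ε_s := −Σ_{i∈ι} J_i · ∏_{j∈T_i} s_j. Then H = Σ_{s ∈ {−1,1}^r} ε_s · Π_s. -/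
open Matrix

noncomputable section

/-- Labels for `n`-qubit Pauli operators: `(0,0) ↦ I`, `(1,0) ↦ X`, `(1,1) ↦ Y`, `(0,1) ↦ Z`. -/
abbrev Lab (n : ℕ) := Fin n → ZMod 2 × ZMod 2

/-- The single-qubit Pauli matrices. -/
def pauli1 : ZMod 2 × ZMod 2 → Matrix (Fin 2) (Fin 2) ℂ := fun p =>
  if p = (0, 0) then 1
  else if p = (1, 0) then !![0, 1; 1, 0]
  else if p = (1, 1) then !![0, -Complex.I; Complex.I, 0]
  else !![1, 0; 0, -1]

/-- The `n`-fold Kronecker product of single-qubit Pauli matrices described by the label `a`. -/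
def nPauli {n : ℕ} (a : Lab n) : Matrix (Fin n → Fin 2) (Fin n → Fin 2) ℂ :=
  Matrix.of fun v w => ∏ i, pauli1 (a i) (v i) (w i)

/-- Ordered product `∏_{j ∈ T} S j` of (commuting) matrices. -/
def prodOver {n r : ℕ} (S : Fin r → Matrix (Fin n → Fin 2) (Fin n → Fin 2) ℂ)
    (T : Finset (Fin r)) : Matrix (Fin n → Fin 2) (Fin n → Fin 2) ℂ :=
  (T.toList.map S).prod

/-- The syndrome projector `Π_s = ∏_j (𝟙 + s_j S_j)/2`. -/
def projMat {n r : ℕ} (S : Fin r → Matrix (Fin n → Fin 2) (Fin n → Fin 2) ℂ)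
    (s : Fin r → ℝ) : Matrix (Fin n → Fin 2) (Fin n → Fin 2) ℂ :=
  ((List.finRange r).map (fun j => (2 : ℂ)⁻¹ • (1 + (s j : ℂ) • S j))).prod

/-- The set `{-1,1}^r` of syndrome (sign) vectors. -/
def signs (r : ℕ) : Finset (Fin r → ℝ) := Fintype.piFinset fun _ => ({-1, 1} : Finset ℝ)

/-- Commuting elements lift to a commutative algebra. -/
lemma exists_comm_lift {M : Type} [Ring M] [Algebra ℂ M] {r : ℕ} (S : Fin r → M)
    (hcomm : ∀ j k, Commute (S j) (S k)) :
    ∃ (A : Type) (_ : CommRing A) (_ : Algebra ℂ A) (φ : A →ₐ[ℂ] M) (x : Fin r → A),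
      ∀ j, φ (x j) = S j := by
  have hc : ∀ a ∈ Set.range S, ∀ b ∈ Set.range S, a * b = b * a := by
    rintro _ ⟨j, rfl⟩ _ ⟨k, rfl⟩
    exact hcomm j k
  exact ⟨Algebra.adjoin ℂ (Set.range S), Algebra.adjoinCommRingOfComm ℂ hc,
    (Algebra.adjoin ℂ (Set.range S)).algebra, (Algebra.adjoin ℂ (Set.range S)).val,
    fun j => ⟨S j, Algebra.subset_adjoin ⟨j, rfl⟩⟩, fun j => rfl⟩

/-- The expansion in a commutative algebra. -/
lemma sum_signs_comm {A : Type} [CommRing A] [Algebra ℂ A] {r : ℕ} (x : Fin r → A)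
    (T : Finset (Fin r)) :
    ∑ s ∈ signs r, ((∏ j ∈ T, s j : ℝ) : ℂ) • ∏ j, ((2 : ℂ)⁻¹ • (1 + (s j : ℂ) • x j))
      = ∏ j ∈ T, x j := by
  have h1 : ∀ s : Fin r → ℝ,
      ((∏ j ∈ T, s j : ℝ) : ℂ) • ∏ j, ((2 : ℂ)⁻¹ • (1 + (s j : ℂ) • x j))
      = ∏ j, ((if j ∈ T then (s j : ℂ) else 1) • ((2 : ℂ)⁻¹ • (1 + (s j : ℂ) • x j))) := by
    intro s
    rw [Finset.prod_smul Finset.univ (fun j => if j ∈ T then (s j : ℂ) else 1)]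
    congr 1
    simp [Finset.prod_ite_mem]
  simp_rw [h1]
  unfold signs
  rw [← Finset.prod_univ_sum (fun _ => ({-1, 1} : Finset ℝ))
    (fun j (t : ℝ) => (if j ∈ T then (t : ℂ) else 1) • ((2 : ℂ)⁻¹ • (1 + (t : ℂ) • x j)))]
  rw [← Finset.prod_subset (Finset.subset_univ T) (f := fun j => if j ∈ T then x j else 1)
    (fun j _ hj => by simp [hj]) |>.symm.trans (Finset.prod_congr rfl fun j hj => by simp [hj])]
  refine Finset.prod_congr rfl fun j _ => ?_
  rw [Finset.sum_pair (by norm_num)]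
  split_ifs
  · push_cast; module
  · push_cast; module

/-- The expansion of a product of stabilizers in the syndrome projectors. -/
lemma prodOver_eq_sum {n r : ℕ} (S : Fin r → Matrix (Fin n → Fin 2) (Fin n → Fin 2) ℂ)
    (hcomm : ∀ j k, Commute (S j) (S k)) (T : Finset (Fin r)) :
    prodOver S T = ∑ s ∈ signs r, ((∏ j ∈ T, s j : ℝ) : ℂ) • projMat S s := by
  obtain ⟨A, _, _, φ, x, hx⟩ := exists_comm_lift S hcomm
  have h := congrArg φ (sum_signs_comm x T)
  rw [map_sum] at h
  have hT : prodOver S T = φ (∏ j ∈ T, x j) := by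
    rw [← Finset.prod_map_toList, map_list_prod, List.map_map]
    unfold prodOver
    congr 2
    funext j
    exact (hx j).symm
  rw [hT, ← h]
  refine Finset.sum_congr rfl fun s _ => ?_
  rw [map_smul]
  congr 1
  rw [← List.prod_ofFn, List.ofFn_eq_map, map_list_prod, List.map_map]
  unfold projMat
  congr 2
  funext j
  rw [Function.comp_apply, map_smul, map_add, map_one, map_smul, hx]

/-- A stabilizer Hamiltonian `H = -∑ i, J i • ∏_{j ∈ T i} S j`
diagonalizes in the basis of syndrome projectors: `H = ∑_{s ∈ {-1,1}^r} ε_s Π_s` with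
`ε_s = -∑ i, J i ∏_{j ∈ T i} s j`. -/
theorem stmt_6 {n r : ℕ} (hn : 1 ≤ n)
    (S : Fin r → Matrix (Fin n → Fin 2) (Fin n → Fin 2) ℂ)
    (hS : ∀ j, S j ∈ Set.range (nPauli (n := n)))
    (hcomm : ∀ j k, Commute (S j) (S k))
    (hind : ∀ T : Finset (Fin r), T.Nonempty → prodOver S T ≠ 1 ∧ prodOver S T ≠ -1)
    {ι : Type*} [Fintype ι] (T : ι → Finset (Fin r)) (J : ι → ℝ)
    (H : Matrix (Fin n → Fin 2) (Fin n → Fin 2) ℂ)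
    (hH : H = -∑ i, (J i : ℂ) • prodOver S (T i))
    (eps : (Fin r → ℝ) → ℝ) (heps : ∀ s, eps s = -∑ i, J i * ∏ j ∈ T i, s j) :
    H = ∑ s ∈ signs r, (eps s : ℂ) • projMat S s := by
  rw [hH]
  simp_rw [prodOver_eq_sum S hcomm, Finset.smul_sum]
  rw [Finset.sum_comm, ← Finset.sum_neg_distrib]
  refine Finset.sum_congr rfl fun s _ => ?_
  rw [heps, Complex.ofReal_neg, Complex.ofReal_sum, neg_smul, Finset.sum_smul]
  congr 1
  refine Finset.sum_congr rfl fun i _ => ?_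
  rw [Complex.ofReal_mul, mul_smul]
end
end

section
/- Let S₁, …, S_r ∈ 𝒫ⁿ be pairwise commuting and independent (∏_{j∈T} S_j ∉ {𝟙, −𝟙} for every nonempty T ⊆ {1,…,r}); for P ∈ 𝒫ⁿ let σ(P) ∈ {−1,1}^r be its syndrome (P·S_j = σ(P)_j·S_j·P) and let s ⊕ u denote componentwise product. Let ι be finite, T_i ⊆ {1,…,r}, J_i ∈ ℝ, g_i := ∏_{j∈T_i} S_j, H := −Σ_i J_i g_i, and ε_s := −Σ_i J_i ∏_{j∈T_i} s_j. For P, U ∈ 𝒫ⁿ set ε̄_P(U) := ‖P U H U P + U H U − P H P − H‖ (operator norm). Then for all P, U ∈ 𝒫ⁿ and all s ∈ {−1,1}^r: ε_{s ⊕ σ(U)} + ε_{s ⊕ σ(U) ⊕ σ(P)} ≤ ε_s + ε_{s ⊕ σ(P)} + ε̄_P(U). -/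
open Matrix

noncomputable section

lemma aux_sum_prod {n : ℕ} (f : Fin n → Fin 2 → ℂ) :
    ∑ v : Fin n → Fin 2, ∏ i, f i (v i) = ∏ i, ∑ x, f i x := by
  rw [Finset.prod_univ_sum, Fintype.piFinset_univ]

lemma aux_zmod2 (x : ZMod 2) : x = 0 ∨ x = 1 := by
  revert x; decide

lemma aux_p00 : pauli1 (0, 0) = !![1, 0; 0, 1] := by
  rw [pauli1, if_pos rfl, Matrix.one_fin_two]

lemma aux_p10 : pauli1 (1, 0) = !![0, 1; 1, 0] := by
  rw [pauli1, if_neg (by decide), if_pos rfl]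

lemma aux_p11 : pauli1 (1, 1) = !![0, -Complex.I; Complex.I, 0] := by
  rw [pauli1, if_neg (by decide), if_neg (by decide), if_pos rfl]

lemma aux_p01 : pauli1 (0, 1) = !![1, 0; 0, -1] := by
  rw [pauli1, if_neg (by decide), if_neg (by decide), if_neg (by decide)]

lemma aux_pauli1_mul (a b : ZMod 2 × ZMod 2) :
    ∃ c : ℂ, pauli1 a * pauli1 b = c • pauli1 (a + b) := by
  obtain ⟨a1, a2⟩ := a
  obtain ⟨b1, b2⟩ := b
  have e : (1 + 1 : ZMod 2) = 0 := by decide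
  rcases aux_zmod2 a1 with rfl | rfl <;> rcases aux_zmod2 a2 with rfl | rfl <;>
    rcases aux_zmod2 b1 with rfl | rfl <;> rcases aux_zmod2 b2 with rfl | rfl <;>
    simp only [Prod.mk_add_mk, e, add_zero, zero_add, aux_p00, aux_p01, aux_p10, aux_p11] <;>
    first
    | (refine ⟨1, ?_⟩; ext i j; fin_cases i <;> fin_cases j <;> simp; done)
    | (refine ⟨Complex.I, ?_⟩; ext i j; fin_cases i <;> fin_cases j <;> simp; done)
    | (refine ⟨-Complex.I, ?_⟩; ext i j; fin_cases i <;> fin_cases j <;> simp; done)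

lemma aux_pauli1_sq (a : ZMod 2 × ZMod 2) : pauli1 a * pauli1 a = 1 := by
  obtain ⟨a1, a2⟩ := a
  rcases aux_zmod2 a1 with rfl | rfl <;> rcases aux_zmod2 a2 with rfl | rfl <;>
    simp only [aux_p00, aux_p01, aux_p10, aux_p11] <;>
    ext i j <;> fin_cases i <;> fin_cases j <;> simp

lemma aux_pauli1_trace (a : ZMod 2 × ZMod 2) (ha : a ≠ 0) : ∑ x, pauli1 a x x = 0 := by
  obtain ⟨a1, a2⟩ := a
  rcases aux_zmod2 a1 with rfl | rfl <;> rcases aux_zmod2 a2 with rfl | rfl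
  · exact absurd rfl ha
  · simp [aux_p01]
  · simp [aux_p10]
  · simp [aux_p11]

lemma aux_pauli1_zero : pauli1 0 = 1 :=
  aux_p00.trans Matrix.one_fin_two.symm

lemma aux_nPauli_mul_apply {n : ℕ} (a b : Lab n) (v w : Fin n → Fin 2) :
    (nPauli a * nPauli b) v w = ∏ i, (pauli1 (a i) * pauli1 (b i)) (v i) (w i) := by
  simp only [Matrix.mul_apply, nPauli, Matrix.of_apply, ← Finset.prod_mul_distrib]
  exact aux_sum_prod (fun i x => pauli1 (a i) (v i) x * pauli1 (b i) x (w i))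

lemma aux_nPauli_zero {n : ℕ} : nPauli (0 : Lab n) = 1 := by
  ext v w
  simp only [nPauli, Matrix.of_apply]
  by_cases h : v = w
  · subst h; simp [aux_pauli1_zero]
  · rw [Matrix.one_apply_ne h]
    obtain ⟨i, hi⟩ := Function.ne_iff.mp h
    apply Finset.prod_eq_zero (Finset.mem_univ i)
    simp [aux_pauli1_zero, hi]

lemma aux_nPauli_mul {n : ℕ} (a b : Lab n) :
    ∃ c : ℂ, nPauli a * nPauli b = c • nPauli (a + b) := by
  choose c hc using fun i => aux_pauli1_mul (a i) (b i)
  refine ⟨∏ i, c i, ?_⟩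
  ext v w
  rw [aux_nPauli_mul_apply]
  simp [hc, nPauli, Finset.prod_mul_distrib]

lemma aux_nPauli_sq {n : ℕ} (a : Lab n) : nPauli a * nPauli a = 1 := by
  rw [← aux_nPauli_zero]
  ext v w
  rw [aux_nPauli_mul_apply]
  simp [aux_pauli1_sq, nPauli, aux_pauli1_zero]

lemma aux_nPauli_trace {n : ℕ} (a : Lab n) (ha : a ≠ 0) : (nPauli a).trace = 0 := by
  simp only [Matrix.trace, Matrix.diag, nPauli, Matrix.of_apply]
  rw [aux_sum_prod (fun i x => pauli1 (a i) x x)]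
  obtain ⟨i, hi⟩ := Function.ne_iff.mp ha
  exact Finset.prod_eq_zero (Finset.mem_univ i) (aux_pauli1_trace _ hi)

section aux
variable {n r : ℕ} (S : Fin r → Matrix (Fin n → Fin 2) (Fin n → Fin 2) ℂ)

lemma aux_prodOver_insert (hcomm : ∀ j k, Commute (S j) (S k)) (j : Fin r)
    (T : Finset (Fin r)) (hj : j ∉ T) :
    prodOver S (insert j T) = S j * prodOver S T := by
  unfold prodOver
  rw [← List.prod_cons, ← List.map_cons]
  apply List.Perm.prod_eq' ((Finset.toList_insert hj).map S)
  rw [List.pairwise_map]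
  exact List.pairwise_of_forall (fun _ _ => hcomm _ _)

lemma aux_prodOver_empty : prodOver S ∅ = 1 := by simp [prodOver]

lemma aux_prodOver_pauli (hS : ∀ j, S j ∈ Set.range (nPauli (n := n)))
    (hcomm : ∀ j k, Commute (S j) (S k)) (T : Finset (Fin r)) :
    ∃ (c : ℂ) (a : Lab n), prodOver S T = c • nPauli a := by
  induction T using Finset.induction_on with
  | empty => exact ⟨1, 0, by simp [aux_prodOver_empty, aux_nPauli_zero]⟩
  | insert j T hj ih =>
    obtain ⟨c, a, h⟩ := ih
    obtain ⟨b, hb⟩ := hS j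
    obtain ⟨d, hd⟩ := aux_nPauli_mul b a
    exact ⟨c * d, b + a, by
      rw [aux_prodOver_insert S hcomm j T hj, h, ← hb, Matrix.mul_smul, hd, smul_smul]⟩

lemma aux_prodOver_conj (hcomm : ∀ j k, Commute (S j) (S k))
    (P : Matrix (Fin n → Fin 2) (Fin n → Fin 2) ℂ) (σ : Fin r → ℝ)
    (h : ∀ j, P * S j = (σ j : ℂ) • (S j * P)) (T : Finset (Fin r)) :
    P * prodOver S T = ((∏ j ∈ T, σ j : ℝ) : ℂ) • (prodOver S T * P) := by
  induction T using Finset.induction_on with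
  | empty => simp [aux_prodOver_empty]
  | insert j T hj ih =>
    rw [aux_prodOver_insert S hcomm j T hj, ← mul_assoc, h j, Matrix.smul_mul, mul_assoc, ih,
      Matrix.mul_smul, smul_smul, Finset.prod_insert hj, mul_assoc]
    push_cast
    rfl

lemma aux_S_sq (hS : ∀ j, S j ∈ Set.range (nPauli (n := n))) (j : Fin r) : S j * S j = 1 := by
  obtain ⟨b, hb⟩ := hS j
  rw [← hb, aux_nPauli_sq]

lemma aux_prodOver_sq (hS : ∀ j, S j ∈ Set.range (nPauli (n := n)))
    (hcomm : ∀ j k, Commute (S j) (S k)) (T : Finset (Fin r)) :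
    prodOver S T * prodOver S T = 1 := by
  induction T using Finset.induction_on with
  | empty => simp [aux_prodOver_empty]
  | insert j T hj ih =>
    have hc := aux_prodOver_conj S hcomm (S j) (fun _ => 1)
      (fun k => by simpa using (hcomm j k).eq) T
    simp only [Finset.prod_const_one, Complex.ofReal_one, one_smul] at hc
    rw [aux_prodOver_insert S hcomm j T hj]
    nth_rewrite 2 [hc]
    rw [mul_assoc, ← mul_assoc (prodOver S T), ih, one_mul, aux_S_sq S hS]

lemma aux_trace (hS : ∀ j, S j ∈ Set.range (nPauli (n := n)))
    (hcomm : ∀ j k, Commute (S j) (S k))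
    (hind : ∀ T : Finset (Fin r), T.Nonempty → prodOver S T ≠ 1 ∧ prodOver S T ≠ -1)
    (T : Finset (Fin r)) (hT : T.Nonempty) : (prodOver S T).trace = 0 := by
  obtain ⟨c, a, h⟩ := aux_prodOver_pauli S hS hcomm T
  by_cases ha : a = 0
  · exfalso
    subst ha
    rw [aux_nPauli_zero] at h
    have hsq := aux_prodOver_sq S hS hcomm T
    rw [h] at hsq
    have h1 := congrFun (congrFun hsq 0) 0
    simp at h1
    have h2 : c = 1 ∨ c = -1 := mul_self_eq_one_iff.mp h1
    rcases h2 with h2 | h2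
    · exact (hind T hT).1 (by rw [h, h2, one_smul])
    · exact (hind T hT).2 (by rw [h, h2, neg_smul, one_smul])
  · rw [h, Matrix.trace_smul, aux_nPauli_trace a ha, smul_zero]

lemma aux_exists_vec (hS : ∀ j, S j ∈ Set.range (nPauli (n := n)))
    (hcomm : ∀ j k, Commute (S j) (S k))
    (hind : ∀ T : Finset (Fin r), T.Nonempty → prodOver S T ≠ 1 ∧ prodOver S T ≠ -1)
    (s : Fin r → ℝ) (hs : ∀ j, s j = 1 ∨ s j = -1) :
    ∃ v : (Fin n → Fin 2) → ℂ, v ≠ 0 ∧ ∀ j, S j *ᵥ v = (s j : ℂ) • v := by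
  set Q : Matrix (Fin n → Fin 2) (Fin n → Fin 2) ℂ :=
    ∑ T : Finset (Fin r), ((∏ j ∈ T, s j : ℝ) : ℂ) • prodOver S T with hQ
  have htr : Q.trace ≠ 0 := by
    rw [hQ, Matrix.trace_sum, Finset.sum_eq_single ∅]
    · simp [aux_prodOver_empty]
    · intro T _ hT
      rw [Matrix.trace_smul, aux_trace S hS hcomm hind T (Finset.nonempty_iff_ne_empty.mpr hT),
        smul_zero]
    · simp
  have hss : ∀ j, s j * s j = 1 := fun j => by rcases hs j with h | h <;> rw [h] <;> norm_num
  have hSQ : ∀ j, S j * Q = (s j : ℂ) • Q := by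
    intro j
    have hinv : Function.Involutive (fun T : Finset (Fin r) => symmDiff T {j}) :=
      fun T => symmDiff_symmDiff_cancel_right _ _
    conv_rhs => rw [hQ, ← Equiv.sum_comp hinv.toPerm]
    rw [hQ, Finset.mul_sum, Finset.smul_sum]
    refine Finset.sum_congr rfl fun T _ => ?_
    rw [Matrix.mul_smul, smul_smul]
    change _ = ((s j : ℂ) * ((∏ k ∈ symmDiff T {j}, s k : ℝ) : ℂ)) • prodOver S (symmDiff T {j})
    by_cases hj : j ∈ T
    · have e : symmDiff T {j} = T.erase j := by
        ext k; simp only [Finset.mem_symmDiff, Finset.mem_singleton, Finset.mem_erase]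
        grind
      rw [e]
      have h1 := aux_prodOver_insert S hcomm j (T.erase j) (Finset.notMem_erase j T)
      rw [Finset.insert_erase hj] at h1
      rw [h1, ← mul_assoc, aux_S_sq S hS, one_mul, ← Finset.mul_prod_erase T s hj]
      push_cast
      rfl
    · have e : symmDiff T {j} = insert j T := by
        ext k; simp only [Finset.mem_symmDiff, Finset.mem_singleton, Finset.mem_insert]
        grind
      rw [e, aux_prodOver_insert S hcomm j T hj, Finset.prod_insert hj, ← Complex.ofReal_mul,
        ← mul_assoc, hss, one_mul]
  have hQ0 : Q ≠ 0 := fun h => htr (by rw [h, Matrix.trace_zero])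
  obtain ⟨x, y, hxy⟩ : ∃ x y, Q x y ≠ 0 := by
    by_contra! hc
    exact hQ0 (by ext x y; simpa using hc x y)
  refine ⟨fun x => Q x y, fun h => hxy (congrFun h x), fun j => ?_⟩
  ext z
  have := congrFun (congrFun (hSQ j) z) y
  simpa [Matrix.mul_apply, Matrix.mulVec, dotProduct] using this

lemma aux_prodOver_vec (hcomm : ∀ j k, Commute (S j) (S k))
    (v : (Fin n → Fin 2) → ℂ) (s : Fin r → ℝ) (h : ∀ j, S j *ᵥ v = (s j : ℂ) • v)
    (T : Finset (Fin r)) : prodOver S T *ᵥ v = ((∏ j ∈ T, s j : ℝ) : ℂ) • v := by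
  induction T using Finset.induction_on with
  | empty => simp [aux_prodOver_empty]
  | insert j T hj ih =>
    rw [aux_prodOver_insert S hcomm j T hj, ← Matrix.mulVec_mulVec, ih, Matrix.mulVec_smul, h,
      smul_smul, Finset.prod_insert hj, mul_comm]
    push_cast
    rfl

/-- Conjugating a stabilizer Hamiltonian by a Pauli twists the couplings. -/
lemma aux_conj_sum (hcomm : ∀ j k, Commute (S j) (S k))
    (P : Matrix (Fin n → Fin 2) (Fin n → Fin 2) ℂ) (hPP : P * P = 1) (σ : Fin r → ℝ)
    (h : ∀ j, P * S j = (σ j : ℂ) • (S j * P))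
    {ι : Type*} [Fintype ι] (T : ι → Finset (Fin r)) (J : ι → ℝ) :
    P * (-∑ i, (J i : ℂ) • prodOver S (T i)) * P
      = -∑ i, ((J i * ∏ j ∈ T i, σ j : ℝ) : ℂ) • prodOver S (T i) := by
  rw [Matrix.mul_neg, Matrix.neg_mul, Finset.mul_sum, Finset.sum_mul]
  congr 1
  refine Finset.sum_congr rfl fun i _ => ?_
  rw [Matrix.mul_smul, aux_prodOver_conj S hcomm P σ h, Matrix.smul_mul, Matrix.smul_mul,
    mul_assoc, hPP, mul_one, smul_smul]
  push_cast
  rfl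

lemma aux_sum_vec (hcomm : ∀ j k, Commute (S j) (S k))
    (v : (Fin n → Fin 2) → ℂ) (s : Fin r → ℝ) (h : ∀ j, S j *ᵥ v = (s j : ℂ) • v)
    {ι : Type*} [Fintype ι] (T : ι → Finset (Fin r)) (J : ι → ℝ) :
    (-∑ i, (J i : ℂ) • prodOver S (T i)) *ᵥ v
      = ((-∑ i, J i * ∏ j ∈ T i, s j : ℝ) : ℂ) • v := by
  rw [Matrix.neg_mulVec, Matrix.sum_mulVec]
  simp only [Matrix.smul_mulVec, aux_prodOver_vec S hcomm v s h, smul_smul]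
  rw [← Finset.sum_smul, ← neg_smul]
  push_cast
  rfl

lemma aux_norm {m : Type*} [Fintype m] [DecidableEq m] (A : Matrix m m ℂ) (v : m → ℂ)
    (hv : v ≠ 0) (c : ℝ) (h : A *ᵥ v = (c : ℂ) • v) : c ≤ opNorm A := by
  have h1 := (Matrix.toEuclideanCLM (𝕜 := ℂ) A).le_opNorm (WithLp.toLp 2 v)
  rw [Matrix.toEuclideanCLM_toLp, h, WithLp.toLp_smul, norm_smul] at h1
  have h2 : 0 < ‖WithLp.toLp 2 v‖ := by
    rw [norm_pos_iff]
    simpa using hv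
  have h3 := le_of_mul_le_mul_right h1 h2
  rw [Complex.norm_real] at h3
  exact (le_abs_self c).trans h3

end aux

/-- Syndrome-energy subadditivity: for a stabilizer Hamiltonian with
syndrome energies `ε_s`, and Paulis `P, U` with syndromes `σP, σU`,
`ε_{s⊕σU} + ε_{s⊕σU⊕σP} ≤ ε_s + ε_{s⊕σP} + ε̄_P(U)` where
`ε̄_P(U) = ‖P U H U P + U H U - P H P - H‖`. -/
theorem stmt_8 {n r : ℕ} (hn : 1 ≤ n)
    (S : Fin r → Matrix (Fin n → Fin 2) (Fin n → Fin 2) ℂ)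
    (hS : ∀ j, S j ∈ Set.range (nPauli (n := n)))
    (hcomm : ∀ j k, Commute (S j) (S k))
    (hind : ∀ T : Finset (Fin r), T.Nonempty → prodOver S T ≠ 1 ∧ prodOver S T ≠ -1)
    {ι : Type*} [Fintype ι] (T : ι → Finset (Fin r)) (J : ι → ℝ)
    (H : Matrix (Fin n → Fin 2) (Fin n → Fin 2) ℂ)
    (hH : H = -∑ i, (J i : ℂ) • prodOver S (T i))
    (eps : (Fin r → ℝ) → ℝ) (heps : ∀ s, eps s = -∑ i, J i * ∏ j ∈ T i, s j)
    (P U : Matrix (Fin n → Fin 2) (Fin n → Fin 2) ℂ)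
    (hP : P ∈ Set.range (nPauli (n := n))) (hU : U ∈ Set.range (nPauli (n := n)))
    (σP σU : Fin r → ℝ)
    (hσPpm : ∀ j, σP j = 1 ∨ σP j = -1) (hσUpm : ∀ j, σU j = 1 ∨ σU j = -1)
    (hσP : ∀ j, P * S j = (σP j : ℂ) • (S j * P))
    (hσU : ∀ j, U * S j = (σU j : ℂ) • (S j * U))
    (Ebar : ℝ) (hEbar : Ebar = opNorm (P * U * H * U * P + U * H * U - P * H * P - H))
    (s : Fin r → ℝ) (hs : ∀ j, s j = 1 ∨ s j = -1) :
    eps (fun j => s j * σU j) + eps (fun j => s j * σU j * σP j)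
      ≤ eps s + eps (fun j => s j * σP j) + Ebar := by
  obtain ⟨p, hp⟩ := hP
  obtain ⟨u, hu⟩ := hU
  have hPP : P * P = 1 := by rw [← hp, aux_nPauli_sq]
  have hUU : U * U = 1 := by rw [← hu, aux_nPauli_sq]
  obtain ⟨v, hv0, hv⟩ := aux_exists_vec S hS hcomm hind s hs
  have e0 := aux_sum_vec S hcomm v s hv T J
  have cU := aux_conj_sum S hcomm U hUU σU hσU T J
  have cP := aux_conj_sum S hcomm P hPP σP hσP T J
  have cPU := aux_conj_sum S hcomm P hPP σP hσP T (fun i => J i * ∏ j ∈ T i, σU j)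
  rw [← cU] at cPU
  have eU := aux_sum_vec S hcomm v s hv T (fun i => J i * ∏ j ∈ T i, σU j)
  have eP := aux_sum_vec S hcomm v s hv T (fun i => J i * ∏ j ∈ T i, σP j)
  have ePU := aux_sum_vec S hcomm v s hv T
    (fun i => (J i * ∏ j ∈ T i, σU j) * ∏ j ∈ T i, σP j)
  rw [← cU] at eU
  rw [← cP] at eP
  rw [← cPU] at ePU
  rw [← hH] at e0 eU eP ePU
  have key := aux_norm (P * U * H * U * P + U * H * U - P * H * P - H) v hv0
    (eps (fun j => s j * σU j * σP j) + eps (fun j => s j * σU j)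
      - eps (fun j => s j * σP j) - eps s) (by
    have a1 : P * U * H * U * P = P * (U * H * U) * P := by simp only [mul_assoc]
    rw [Matrix.sub_mulVec, Matrix.sub_mulVec, Matrix.add_mulVec, a1, e0, eU, eP, ePU,
      ← add_smul, ← sub_smul, ← sub_smul]
    congr 1
    rw [← Complex.ofReal_add, ← Complex.ofReal_sub, ← Complex.ofReal_sub]
    congr 1
    simp only [heps, Finset.prod_mul_distrib]
    congr 1
    congr 1
    · congr 1
      · congr 1
        exact Finset.sum_congr rfl fun i _ => by ring
      · congr 1
        exact Finset.sum_congr rfl fun i _ => by ring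
    · congr 1
      exact Finset.sum_congr rfl fun i _ => by ring)
  rw [← hEbar] at key
  linarith
end
end

section
/- Let N, K, M ≥ 1, A ∈ M_{N×K}(ℂ), W ∈ M_{K×M}(ℂ), and B := A·W. For k ∈ {1,…,K} let w_k denote the k-th row of W, and set τ := max_{m ∈ {1,…,M}} Σ_{k : W_{k,m} ≠ 0} ‖w_k‖₂². Then the matrix τ·A·A† − B·B† is positive semidefinite. -/
open Matrix
open scoped ComplexOrder

lemma dot_star_self_aux {n : ℕ} (x : Fin n → ℂ) :
    star x ⬝ᵥ x = ((∑ i, ‖x i‖ ^ 2 : ℝ) : ℂ) := by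
  simp only [dotProduct, Pi.star_apply, RCLike.star_def, Complex.conj_mul']
  push_cast
  rfl

open scoped Classical in
lemma real_bound_aux {K M : ℕ} (W : Matrix (Fin K) (Fin M) ℂ) (τ : ℝ)
    (hτ : ∀ m : Fin M,
      ∑ k ∈ Finset.univ.filter (fun k => W k m ≠ 0), ∑ m' : Fin M, ‖W k m'‖ ^ 2 ≤ τ)
    (hτ0 : 0 ≤ τ) (x : Fin K → ℂ) :
    ∑ m, ‖(Wᴴ *ᵥ x) m‖ ^ 2 ≤ τ * ∑ k, ‖x k‖ ^ 2 := by
  set r : Fin K → ℝ := fun k => ∑ m' : Fin M, ‖W k m'‖ ^ 2 with hr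
  have hr0 : ∀ k, 0 ≤ r k := fun k => Finset.sum_nonneg fun _ _ => by positivity
  have hpos : ∀ k m, W k m ≠ 0 → 0 < r k := by
    intro k m h
    have h1 : ‖W k m‖ ^ 2 ≤ r k :=
      Finset.single_le_sum (f := fun m' => ‖W k m'‖ ^ 2) (fun _ _ => by positivity)
        (Finset.mem_univ m)
    have h2 : 0 < ‖W k m‖ := norm_pos_iff.mpr h
    have : 0 < ‖W k m‖ ^ 2 := by positivity
    linarith
  have key : ∀ m, ‖(Wᴴ *ᵥ x) m‖ ^ 2 ≤ τ * ∑ k, ‖W k m‖ ^ 2 * ‖x k‖ ^ 2 / r k := by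
    intro m
    have h1 : ‖(Wᴴ *ᵥ x) m‖
        ≤ ∑ k ∈ Finset.univ.filter (fun k => W k m ≠ 0), ‖W k m‖ * ‖x k‖ := by
      have e : (Wᴴ *ᵥ x) m
          = ∑ k ∈ Finset.univ.filter (fun k => W k m ≠ 0), star (W k m) * x k := by
        simp only [mulVec, dotProduct, conjTranspose_apply]
        symm
        apply Finset.sum_subset (Finset.filter_subset _ _)
        intro k _ hk
        have : W k m = 0 := by simpa using hk
        simp [this]
      rw [e]
      refine (norm_sum_le _ _).trans (le_of_eq ?_)
      simp
    have h2 := Finset.sum_sq_le_sum_mul_sum_of_sq_eq_mul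
      (Finset.univ.filter (fun k => W k m ≠ 0)) (r := fun k => ‖W k m‖ * ‖x k‖)
      (f := r) (g := fun k => ‖W k m‖ ^ 2 * ‖x k‖ ^ 2 / r k)
      (fun k _ => hr0 k)
      (fun k _ => div_nonneg (by positivity) (hr0 k))
      (fun k hk => by
        have := hpos k m (by simpa using hk)
        field_simp)
    have h3 : ∑ k ∈ Finset.univ.filter (fun k => W k m ≠ 0), ‖W k m‖ ^ 2 * ‖x k‖ ^ 2 / r k
        ≤ ∑ k, ‖W k m‖ ^ 2 * ‖x k‖ ^ 2 / r k :=
      Finset.sum_le_sum_of_subset_of_nonneg (Finset.filter_subset _ _)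
        (fun k _ _ => div_nonneg (by positivity) (hr0 k))
    calc ‖(Wᴴ *ᵥ x) m‖ ^ 2 ≤ _ := pow_le_pow_left₀ (norm_nonneg _) h1 2
      _ ≤ _ := h2
      _ ≤ _ := mul_le_mul (hτ m) h3
        (Finset.sum_nonneg fun k _ => div_nonneg (by positivity) (hr0 k)) hτ0
  calc _ ≤ ∑ m, τ * ∑ k, ‖W k m‖ ^ 2 * ‖x k‖ ^ 2 / r k := Finset.sum_le_sum fun m _ => key m
    _ = τ * ∑ k, r k * ‖x k‖ ^ 2 / r k := by
      rw [← Finset.mul_sum, Finset.sum_comm]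
      congr 1
      refine Finset.sum_congr rfl fun k _ => ?_
      rw [← Finset.sum_div, ← Finset.sum_mul]
    _ ≤ _ := by
      refine mul_le_mul_of_nonneg_left (Finset.sum_le_sum fun k _ => ?_) hτ0
      by_cases h : r k = 0
      · rw [h]; simp
      · rw [mul_div_cancel_left₀ _ h]

open scoped Classical in
/-- (Boman–Hendrickson/Chen–Toledo support-number bound.) If `B = A·W`
and `τ = max_m ∑_{k : W k m ≠ 0} ‖w_k‖₂²` (with `w_k` the `k`-th row of `W`), then
`τ·A·A† − B·B†` is positive semidefinite. -/
theorem stmt_10 {N K M : ℕ} (hN : 1 ≤ N) (hK : 1 ≤ K) (hM : 1 ≤ M)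
    (A : Matrix (Fin N) (Fin K) ℂ) (W : Matrix (Fin K) (Fin M) ℂ)
    (B : Matrix (Fin N) (Fin M) ℂ) (hB : B = A * W)
    (τ : ℝ)
    (hτ : τ = ⨆ m : Fin M,
      ∑ k ∈ Finset.univ.filter (fun k => W k m ≠ 0), ∑ m' : Fin M, ‖W k m'‖ ^ 2) :
    ((τ : ℂ) • (A * Aᴴ) - B * Bᴴ).PosSemidef := by
  have hle : ∀ m : Fin M,
      ∑ k ∈ Finset.univ.filter (fun k => W k m ≠ 0), ∑ m' : Fin M, ‖W k m'‖ ^ 2 ≤ τ := by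
    intro m
    rw [hτ]
    exact le_ciSup (f := fun m : Fin M =>
      ∑ k ∈ Finset.univ.filter (fun k => W k m ≠ 0), ∑ m' : Fin M, ‖W k m'‖ ^ 2)
      (Set.finite_range _).bddAbove m
  have h0 : 0 ≤ τ := by
    refine le_trans ?_ (hle ⟨0, hM⟩)
    positivity
  have hb := real_bound_aux W τ hle h0
  have hP : ((τ : ℂ) • (1 : Matrix (Fin K) (Fin K) ℂ) - W * Wᴴ).PosSemidef := by
    refine Matrix.PosSemidef.of_dotProduct_mulVec_nonneg ?_ ?_
    · refine IsHermitian.sub ?_ (isHermitian_mul_conjTranspose_self W)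
      simp [IsHermitian, conjTranspose_smul]
    · intro x
      have e : star x ⬝ᵥ (((τ : ℂ) • (1 : Matrix (Fin K) (Fin K) ℂ) - W * Wᴴ) *ᵥ x)
          = ((τ * ∑ k, ‖x k‖ ^ 2 - ∑ m, ‖(Wᴴ *ᵥ x) m‖ ^ 2 : ℝ) : ℂ) := by
        rw [sub_mulVec, dotProduct_sub, smul_mulVec, one_mulVec, dotProduct_smul,
          ← mulVec_mulVec, dotProduct_mulVec, Complex.ofReal_sub, Complex.ofReal_mul,
          ← dot_star_self_aux, ← dot_star_self_aux, star_mulVec, conjTranspose_conjTranspose,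
          smul_eq_mul]
      rw [e]
      exact_mod_cast sub_nonneg.mpr (hb x)
  have := hP.mul_mul_conjTranspose_same A
  convert this using 1
  rw [hB, conjTranspose_mul]
  simp [Matrix.mul_sub, Matrix.sub_mul, Matrix.mul_assoc]
end

section
/- Let G be a group, A an additive abelian group, σ : G → A a group homomorphism, and θ : G → {−1, 1} ⊆ ℂ a group homomorphism. Let V be a complex vector space and v : A → V any function. For α ∈ G and u ∈ A define w_α(u) := (1/√2)·(v(u) − θ(α)·v(u + σ(α))). Then for every finite sequence U₀, U₁, …, U_T in G with U₀ = 1, setting P := U_T and α_{t+1} := U_t⁻¹·U_{t+1}, one has w_P(u) = Σ_{t=0}^{T−1} θ(U_t) · w_{α_{t+1}}(u + σ(U_t)) for every u ∈ A. -/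
/-- (Abstract telescopic property, Proposition 9 of Temme.) Let
`σ : G → A` be a homomorphism to an abelian group, `θ : G → {±1} ⊆ ℂ` multiplicative,
`v : A → V`, and `w_α(u) = (1/√2)(v(u) − θ(α)·v(u + σ(α)))`. Then for any finite sequence
`U₀ = 1, U₁, …, U_T` in `G`, with `P = U_T` and `α_{t+1} = U_t⁻¹ U_{t+1}`,
`w_P(u) = ∑_{t<T} θ(U_t) • w_{α_{t+1}}(u + σ(U_t))`. -/
theorem stmt_12 {G : Type*} [Group G] {A : Type*} [AddCommGroup A]
    (σ : G → A) (hσ : ∀ x y, σ (x * y) = σ x + σ y)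
    (θ : G → ℂ) (hθmul : ∀ x y, θ (x * y) = θ x * θ y)
    (hθpm : ∀ x, θ x = 1 ∨ θ x = -1)
    {V : Type*} [AddCommGroup V] [Module ℂ V]
    (v : A → V)
    (w : G → A → V)
    (hw : ∀ α u, w α u = ((Real.sqrt 2 : ℂ))⁻¹ • (v u - θ α • v (u + σ α)))
    {T : ℕ} (U : Fin (T + 1) → G) (hU0 : U 0 = 1)
    (u : A) :
    w (U (Fin.last T)) u
      = ∑ t : Fin T, θ (U t.castSucc) •
          w ((U t.castSucc)⁻¹ * U t.succ) (u + σ (U t.castSucc)) := by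
  have h1 : θ 1 = 1 := by
    have h := hθmul 1 1
    rcases hθpm 1 with h' | h'
    · exact h'
    · rw [mul_one, h'] at h
      norm_num at h
  have hs1 : σ 1 = 0 := by
    have h := hσ 1 1
    rw [mul_one] at h
    simpa using h
  have step : ∀ a b : G, θ a • w (a⁻¹ * b) (u + σ a) =
      ((Real.sqrt 2 : ℂ))⁻¹ • (θ a • v (u + σ a) - θ b • v (u + σ b)) := by
    intro a b
    have e1 : θ a * θ (a⁻¹ * b) = θ b := by rw [← hθmul, mul_inv_cancel_left]
    have e2 : σ a + σ (a⁻¹ * b) = σ b := by rw [← hσ, mul_inv_cancel_left]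
    rw [hw, add_assoc, e2, smul_comm, smul_sub, smul_smul (θ a), e1]
  induction T with
  | zero =>
    have : U (Fin.last 0) = 1 := hU0
    rw [this, hw, h1, hs1]
    simp
  | succ n ih =>
    rw [Fin.sum_univ_castSucc]
    have h := ih (fun i => U i.castSucc) hU0
    simp only [← Fin.succ_castSucc] at h
    simp only [Fin.succ_last]
    rw [← h, step, hw, hw, ← smul_add]
    simp
end
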